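/- arXiv:2502.19775 — 2 statements merged into one kernel-verified Lean document; each statement's English description precedes it below -/
import Mathlib

section
/- For every α > 0 there exists C_α > 0 such that for every measurable u : ℝ² → ℝ with ∫_{ℝ²} u(y)² (1+|y|)^{2+α} dy < ∞, the 2D Poisson field Ψ_u(x) = −(1/(2π)) ∫_{ℝ²} log|x−y| u(y) dy is defined at every x ∈ ℝ² and satisfies sup_{|x| ≤ 1} |Ψ_u(x)|² + sup_{|x| > 1} ( Ψ_u(x)/(1 + log|x|) )² ≤ C_α ∫_{ℝ²} u(y)² (1+|y|)^{2+α} dy. If, in addition, ∫_{ℝ²} u = 0, then sup_{x ∈ ℝ²} |Ψ_u(x)|² ≤ C_α ∫_{ℝ²} u(y)² (1+|y|)^{2+α} dy. -/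
open MeasureTheory

noncomputable section

abbrev E2 : Type := EuclideanSpace ℝ (Fin 2)

/-- The 2D Poisson field `Ψ_u(x) = −(1/2π) ∫ log|x−y| u(y) dy`. -/
def Psi (u : E2 → ℝ) (x : E2) : ℝ :=
  -(1 / (2 * Real.pi)) * ∫ y : E2, Real.log ‖x - y‖ * u y

lemma aux_cs {f g : E2 → ℝ} (hf : MemLp f 2) (hg : MemLp g 2) :
    Integrable (fun y => f y * g y) ∧
      (∫ y, f y * g y) ^ 2 ≤ (∫ y, f y ^ 2) * ∫ y, g y ^ 2 := by
  have hfg : Integrable (fun y => f y * g y) := hf.integrable_mul hg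
  have hf2 := hf.integrable_sq
  have hg2 := hg.integrable_sq
  refine ⟨hfg, ?_⟩
  have h : ∀ t : ℝ, 0 ≤ (∫ y, f y ^ 2) * (t * t) + (2 * ∫ y, f y * g y) * t + ∫ y, g y ^ 2 := by
    intro t
    have h1 : 0 ≤ ∫ y, (t * f y + g y) ^ 2 := integral_nonneg fun y => sq_nonneg _
    have h2 : ∫ y, (t * f y + g y) ^ 2
        = ∫ y, ((t * t) * f y ^ 2 + (2 * t) * (f y * g y)) + g y ^ 2 := by
      congr 1; ext y; ring
    have h3 : Integrable (fun y => (t * t) * f y ^ 2 + (2 * t) * (f y * g y)) :=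
      (hf2.const_mul _).add (hfg.const_mul _)
    rw [h2, integral_add h3 hg2,
      integral_add (hf2.const_mul _) (hfg.const_mul _), integral_const_mul,
      integral_const_mul] at h1
    linarith
  have := discrim_le_zero h
  unfold discrim at this
  nlinarith

lemma aux_w (α : ℝ) {k u G : E2 → ℝ} (hk : Measurable k) (hu : Measurable u)
    (hG : Integrable G) (hkG : ∀ y, k y ^ 2 * (1 + ‖y‖) ^ (-(2 + α)) ≤ G y)
    (hA : Integrable (fun y : E2 => (u y) ^ 2 * (1 + ‖y‖) ^ (2 + α))) :
    Integrable (fun y => k y * u y) ∧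
      (∫ y, k y * u y) ^ 2 ≤ (∫ y, G y) * ∫ y, (u y) ^ 2 * (1 + ‖y‖) ^ (2 + α) := by
  have hpos : ∀ y : E2, 0 < 1 + ‖y‖ := fun y => by positivity
  have e1 : ∀ y : E2, (k y * (1 + ‖y‖) ^ (-(2 + α) / 2)) ^ 2 = k y ^ 2 * (1 + ‖y‖) ^ (-(2 + α)) := by
    intro y
    rw [mul_pow, ← Real.rpow_mul_natCast (hpos y).le]
    congr 2; push_cast; ring
  have e2 : ∀ y : E2, (u y * (1 + ‖y‖) ^ ((2 + α) / 2)) ^ 2 = u y ^ 2 * (1 + ‖y‖) ^ (2 + α) := by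
    intro y
    rw [mul_pow, ← Real.rpow_mul_natCast (hpos y).le]
    congr 2; push_cast; ring
  have e3 : ∀ y : E2, (k y * (1 + ‖y‖) ^ (-(2 + α) / 2)) * (u y * (1 + ‖y‖) ^ ((2 + α) / 2))
      = k y * u y := by
    intro y
    have : (1 + ‖y‖) ^ (-(2 + α) / 2) * (1 + ‖y‖) ^ ((2 + α) / 2) = 1 := by
      rw [← Real.rpow_add (hpos y), show -(2 + α) / 2 + (2 + α) / 2 = 0 by ring, Real.rpow_zero]
    linear_combination (k y * u y) * this
  have m1 : Measurable (fun y : E2 => k y * (1 + ‖y‖) ^ (-(2 + α) / 2)) := by fun_prop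
  have m2 : Measurable (fun y : E2 => u y * (1 + ‖y‖) ^ ((2 + α) / 2)) := by fun_prop
  have i1 : Integrable (fun y : E2 => (k y * (1 + ‖y‖) ^ (-(2 + α) / 2)) ^ 2) := by
    refine hG.mono' (m1.pow_const 2).aestronglyMeasurable (Filter.Eventually.of_forall fun y => ?_)
    rw [Real.norm_of_nonneg (sq_nonneg _), e1]
    exact hkG y
  have i2 : Integrable (fun y : E2 => (u y * (1 + ‖y‖) ^ ((2 + α) / 2)) ^ 2) := by
    simpa only [e2] using hA
  have := aux_cs ((memLp_two_iff_integrable_sq m1.aestronglyMeasurable).2 i1)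
    ((memLp_two_iff_integrable_sq m2.aestronglyMeasurable).2 i2)
  simp only [e3, e2] at this
  refine ⟨this.1, this.2.trans ?_⟩
  refine mul_le_mul_of_nonneg_right (integral_mono i1 hG fun y => ?_)
    (integral_nonneg fun y => ?_)
  · rw [e1]; exact hkG y
  · have := hpos y
    positivity

lemma aux_L : Integrable (fun z : E2 => (max (-Real.log ‖z‖) 0) ^ 2) := by
  have := (integrable_fun_norm_addHaar (volume : Measure E2)
    (f := fun r : ℝ => (max (-Real.log r) 0) ^ 2))
  rw [this]
  simp only [finrank_euclideanSpace, Fintype.card_fin, Nat.add_one_sub_one, pow_one, smul_eq_mul]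
  have hi : Integrable ((Set.Ioc (0:ℝ) 1).indicator (fun _ => (4:ℝ))) := by
    rw [integrable_indicator_iff measurableSet_Ioc]
    exact integrableOn_const (by simp)
  refine Integrable.mono' hi.integrableOn (by fun_prop) ?_
  refine (ae_restrict_iff' measurableSet_Ioi).2 (Filter.Eventually.of_forall fun r hr => ?_)
  have hr : 0 < r := hr
  rw [Real.norm_of_nonneg (by positivity)]
  by_cases h1 : r ≤ 1
  · rw [Set.indicator_of_mem (show r ∈ Set.Ioc (0:ℝ) 1 from ⟨hr, h1⟩)]
    have hl := Real.log_nonpos hr.le h1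
    rw [max_eq_left (by linarith)]
    have := Real.abs_log_mul_self_rpow_lt r (1/2) hr h1 (by norm_num)
    have h2 : (Real.log r * r ^ (1/2:ℝ)) ^ 2 ≤ 2 ^ 2 := by
      rw [sq_le_sq]; norm_num at this ⊢; exact this.le
    rw [mul_pow, ← Real.rpow_mul_natCast hr.le] at h2
    norm_num at h2
    nlinarith
  · rw [Set.indicator_of_notMem (by simp [h1])]
    push Not at h1
    have hl := Real.log_nonneg h1.le
    rw [max_eq_right (by linarith)]
    simp

lemma aux_K (x y : E2) :
    |Real.log ‖x - y‖ - Real.log (1 + ‖x‖)| ≤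
      Real.log (2 + ‖y‖) + max (-Real.log ‖x - y‖) 0 := by
  have hx := norm_nonneg x
  have hy := norm_nonneg y
  have hy2 : 0 ≤ Real.log (2 + ‖y‖) := Real.log_nonneg (by linarith)
  have hm := le_max_left (-Real.log ‖x - y‖) 0
  have hm0 := le_max_right (-Real.log ‖x - y‖) 0
  have hx1 : ‖x‖ ≤ ‖y‖ + ‖x - y‖ := by
    have := norm_add_le y (x - y); simpa using this
  rcases eq_or_lt_of_le (norm_nonneg (x - y)) with h | h
  · rw [← h] at hx1 hm0 ⊢
    simp only [Real.log_zero, zero_sub, abs_neg]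
    rw [abs_of_nonneg (Real.log_nonneg (by linarith))]
    have : Real.log (1 + ‖x‖) ≤ Real.log (2 + ‖y‖) := Real.log_le_log (by linarith) (by linarith)
    simpa using this
  have hs : ‖x - y‖ ≤ ‖x‖ + ‖y‖ := norm_sub_le x y
  rw [abs_le]
  constructor
  · by_cases h1 : ‖x - y‖ < 1
    · have : Real.log (1 + ‖x‖) ≤ Real.log (2 + ‖y‖) := Real.log_le_log (by linarith) (by linarith)
      linarith
    · push Not at h1
      have : Real.log (1 + ‖x‖) ≤ Real.log ((2 + ‖y‖) * ‖x - y‖) :=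
        Real.log_le_log (by linarith) (by nlinarith)
      rw [Real.log_mul (by positivity) h.ne'] at this
      linarith
  · have : Real.log ‖x - y‖ ≤ Real.log ((2 + ‖y‖) * (1 + ‖x‖)) :=
      Real.log_le_log h (by nlinarith)
    rw [Real.log_mul (by positivity) (by positivity)] at this
    linarith

lemma aux_W (α : ℝ) (hα : 0 < α) :
    Integrable (fun y : E2 => Real.log (2 + ‖y‖) ^ 2 * (1 + ‖y‖) ^ (-(2 + α))) := by
  have h0 : Integrable (fun y : E2 => (1 + ‖y‖) ^ (-(2 + α / 2))) :=
    integrable_one_add_norm (by simp; linarith)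
  refine (h0.const_mul ((2 ^ (α / 4) / (α / 4)) ^ 2)).mono' (by fun_prop)
    (Filter.Eventually.of_forall fun y => ?_)
  have hy := norm_nonneg y
  have hp : 0 < 1 + ‖y‖ := by linarith
  rw [Real.norm_of_nonneg (by positivity)]
  have h1 : Real.log (2 + ‖y‖) ≤ (2 + ‖y‖) ^ (α / 4) / (α / 4) :=
    Real.log_le_rpow_div (by linarith) (by linarith)
  have h2 : (2 + ‖y‖) ^ (α / 4) ≤ 2 ^ (α / 4) * (1 + ‖y‖) ^ (α / 4) := by
    rw [← Real.mul_rpow (by norm_num) hp.le]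
    exact Real.rpow_le_rpow (by linarith) (by linarith) (by linarith)
  have h3 : Real.log (2 + ‖y‖) ≤ 2 ^ (α / 4) / (α / 4) * (1 + ‖y‖) ^ (α / 4) := by
    refine h1.trans ?_
    rw [div_mul_eq_mul_div]
    gcongr
  have h4 : Real.log (2 + ‖y‖) ^ 2 ≤ (2 ^ (α / 4) / (α / 4) * (1 + ‖y‖) ^ (α / 4)) ^ 2 :=
    pow_le_pow_left₀ (Real.log_nonneg (by linarith)) h3 2
  refine (mul_le_mul_of_nonneg_right h4 (by positivity)).trans (le_of_eq ?_)
  rw [mul_pow, ← Real.rpow_mul_natCast hp.le, mul_assoc, ← Real.rpow_add hp]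
  congr 2; push_cast; ring

/-- pointwise estimates on the 2D Poisson field by a weighted L² norm. -/
theorem stmt15 (α : ℝ) (hα : 0 < α) :
    ∃ Cα : ℝ, 0 < Cα ∧
      ∀ u : E2 → ℝ, Measurable u →
        Integrable (fun y : E2 => (u y) ^ 2 * (1 + ‖y‖) ^ (2 + α)) →
        (∀ x : E2, Integrable (fun y : E2 => Real.log ‖x - y‖ * u y)) ∧
        (∀ x : E2, ‖x‖ ≤ 1 →
            (Psi u x) ^ 2 ≤ Cα * ∫ y : E2, (u y) ^ 2 * (1 + ‖y‖) ^ (2 + α)) ∧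
        (∀ x : E2, 1 < ‖x‖ →
            (Psi u x / (1 + Real.log ‖x‖)) ^ 2
              ≤ Cα * ∫ y : E2, (u y) ^ 2 * (1 + ‖y‖) ^ (2 + α)) ∧
        ((∫ y : E2, u y) = 0 →
          ∀ x : E2, (Psi u x) ^ 2 ≤ Cα * ∫ y : E2, (u y) ^ 2 * (1 + ‖y‖) ^ (2 + α)) := by
  have hw : Integrable (fun y : E2 => (1 + ‖y‖) ^ (-(2 + α))) :=
    integrable_one_add_norm (by simp; linarith)
  have hW := aux_W α hα
  have hL := aux_L
  obtain ⟨M1, hM1⟩ : ∃ M, M = ∫ y : E2, (1 + ‖y‖) ^ (-(2 + α)) := ⟨_, rfl⟩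
  obtain ⟨M2, hM2⟩ : ∃ M, M = 2 * (∫ y : E2, Real.log (2 + ‖y‖) ^ 2 * (1 + ‖y‖) ^ (-(2 + α)))
    + 2 * ∫ z : E2, (max (-Real.log ‖z‖) 0) ^ 2 := ⟨_, rfl⟩
  have hM1' : 0 ≤ M1 := hM1 ▸ integral_nonneg fun y => by positivity
  have hM2' : 0 ≤ M2 := by
    rw [hM2]
    have a1 : 0 ≤ ∫ y : E2, Real.log (2 + ‖y‖) ^ 2 * (1 + ‖y‖) ^ (-(2 + α)) :=
      integral_nonneg fun y => by positivity
    have a2 : 0 ≤ ∫ z : E2, (max (-Real.log ‖z‖) 0) ^ 2 :=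
      integral_nonneg fun y => by positivity
    linarith
  refine ⟨2 * M1 + 2 * M2 + 1, by linarith, fun u hu hA => ?_⟩
  obtain ⟨A, hAe⟩ : ∃ A, A = ∫ y : E2, (u y) ^ 2 * (1 + ‖y‖) ^ (2 + α) := ⟨_, rfl⟩
  have hA0 : 0 ≤ A := hAe ▸ integral_nonneg fun y => by positivity
  obtain ⟨iu, bu⟩ := aux_w α (k := fun _ => 1) measurable_const hu hw (fun y => by simp) hA
  simp only [one_mul] at iu bu
  rw [← hM1, ← hAe] at bu
  have key : ∀ x : E2, Integrable (fun y => (Real.log ‖x - y‖ - Real.log (1 + ‖x‖)) * u y) ∧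
      (∫ y, (Real.log ‖x - y‖ - Real.log (1 + ‖x‖)) * u y) ^ 2 ≤ M2 * A := by
    intro x
    have hLx : Integrable (fun y : E2 => (max (-Real.log ‖x - y‖) 0) ^ 2) :=
      hL.comp_sub_left x
    have := aux_w α (k := fun y => Real.log ‖x - y‖ - Real.log (1 + ‖x‖)) (by fun_prop) hu
      ((hW.const_mul 2).add (hLx.const_mul 2)) (fun y => ?_) hA
    · simp only [Pi.add_apply] at this
      rw [integral_add (hW.const_mul 2) (hLx.const_mul 2), integral_const_mul, integral_const_mul,
        integral_sub_left_eq_self (fun z : E2 => (max (-Real.log ‖z‖) 0) ^ 2) volume x,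
        ← hM2, ← hAe] at this
      exact this
    · have hk := aux_K x y
      have hy := norm_nonneg y
      simp only [Pi.add_apply]
      set a := Real.log (2 + ‖y‖)
      set b := max (-Real.log ‖x - y‖) 0
      set k := Real.log ‖x - y‖ - Real.log (1 + ‖x‖)
      have h1 : k ^ 2 ≤ (a + b) ^ 2 := sq_le_sq' (by linarith [abs_le.1 hk]) (abs_le.1 hk).2
      have hw0 : 0 ≤ (1 + ‖y‖) ^ (-(2 + α)) := by positivity
      have hw1 : (1 + ‖y‖) ^ (-(2 + α)) ≤ 1 :=
        Real.rpow_le_one_of_one_le_of_nonpos (by linarith) (by linarith)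
      set w := (1 + ‖y‖) ^ (-(2 + α))
      have h2 : k ^ 2 ≤ 2 * a ^ 2 + 2 * b ^ 2 := by nlinarith [sq_nonneg (a - b)]
      have h3 : k ^ 2 * w ≤ (2 * a ^ 2 + 2 * b ^ 2) * w := mul_le_mul_of_nonneg_right h2 hw0
      have h4 : b ^ 2 * w ≤ b ^ 2 := mul_le_of_le_one_right (sq_nonneg _) hw1
      linarith
  have hsplit : ∀ x : E2, (fun y : E2 => Real.log ‖x - y‖ * u y) = fun y =>
      (Real.log ‖x - y‖ - Real.log (1 + ‖x‖)) * u y + Real.log (1 + ‖x‖) * u y := by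
    intro x; ext y; ring
  have hint : ∀ x : E2, Integrable (fun y : E2 => Real.log ‖x - y‖ * u y) := by
    intro x
    rw [hsplit x]
    exact (key x).1.add (iu.const_mul _)
  have hPsi : ∀ x : E2, Psi u x = -(1 / (2 * Real.pi)) *
      ((∫ y, (Real.log ‖x - y‖ - Real.log (1 + ‖x‖)) * u y)
        + Real.log (1 + ‖x‖) * ∫ y, u y) := by
    intro x
    unfold Psi
    rw [hsplit x, integral_add (key x).1 (iu.const_mul _), integral_const_mul]
  have hpi : (-(1 / (2 * Real.pi))) ^ 2 ≤ 1 := by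
    rw [neg_sq]
    have := Real.pi_gt_three
    refine pow_le_one₀ (by positivity) ?_
    rw [div_le_one (by positivity)]
    linarith
  have main : ∀ (x : E2) (c : ℝ), 1 ≤ c → Real.log (1 + ‖x‖) ≤ c →
      (Psi u x) ^ 2 ≤ c ^ 2 * ((2 * M1 + 2 * M2 + 1) * A) := by
    intro x c hc hl
    have hl0 : 0 ≤ Real.log (1 + ‖x‖) := Real.log_nonneg (by linarith [norm_nonneg x])
    rw [hPsi x, mul_pow]
    have hk := (key x).2
    set I := ∫ y, (Real.log ‖x - y‖ - Real.log (1 + ‖x‖)) * u y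
    set J := ∫ y, u y
    set l := Real.log (1 + ‖x‖)
    have h1 : (I + l * J) ^ 2 ≤ 2 * I ^ 2 + 2 * (l ^ 2 * J ^ 2) := by
      nlinarith [sq_nonneg (I - l * J)]
    have h2 : l ^ 2 * J ^ 2 ≤ c ^ 2 * (M1 * A) :=
      mul_le_mul (pow_le_pow_left₀ hl0 hl 2) bu (sq_nonneg _) (sq_nonneg _)
    have h3 : I ^ 2 ≤ c ^ 2 * (M2 * A) :=
      hk.trans (le_mul_of_one_le_left (by positivity) (one_le_pow₀ hc))
    have h4 : 0 ≤ c ^ 2 * A := by positivity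
    have h5 := mul_le_of_le_one_left (sq_nonneg (I + l * J)) hpi
    nlinarith
  rw [← hAe]
  refine ⟨hint, fun x hx => ?_, fun x hx => ?_, fun h0 x => ?_⟩
  · have := main x 1 le_rfl ((Real.log_le_sub_one_of_pos (by positivity)).trans (by linarith))
    simpa using this
  · have hl : 0 < Real.log ‖x‖ := Real.log_pos hx
    rw [div_pow, div_le_iff₀ (by positivity), mul_comm _ ((1 + Real.log ‖x‖) ^ 2)]
    refine main x _ (by linarith) ?_
    have : Real.log (1 + ‖x‖) ≤ Real.log (2 * ‖x‖) :=
      Real.log_le_log (by linarith) (by linarith)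
    rw [Real.log_mul (by norm_num) (by positivity)] at this
    linarith [Real.log_two_lt_d9]
  · rw [hPsi x, h0, mul_zero, add_zero, mul_pow]
    have hk := (key x).2
    have h5 := mul_le_of_le_one_left
      (sq_nonneg (∫ y, (Real.log ‖x - y‖ - Real.log (1 + ‖x‖)) * u y)) hpi
    have : 0 ≤ M1 * A := by positivity
    have : 0 ≤ M2 * A := by positivity
    nlinarith
end
end

section
/- For every α ∈ (0,2) there exists C_α > 0 such that the following holds. Let u : ℝ² → ℝ be continuous with ∫_{ℝ²} u(y)² (1+|y|)^{2α} dy < ∞ and with vanishing angular average, i.e. ∫_0^{2π} u(γ cos θ, γ sin θ) dθ = 0 for every γ > 0. Then its 2D Poisson field Ψ_u satisfies, for every γ > 0 (writing Ψ_u and ∇Ψ_u in polar coordinates, with ∇Ψ_u(x) = −(1/(2π)) ∫_{ℝ²} (x−y)/|x−y|² u(y) dy): ∫_0^{2π} ( |Ψ_u(γ,θ)|² + γ² |∇Ψ_u(γ,θ)|² ) dθ ≤ C_α γ² (1+γ)^{−2α} (1 + 1_{γ ≤ 1} |log γ|) ∫_{ℝ²} u(y)² (1+|y|)^{2α} dy.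 -/
open MeasureTheory

noncomputable section

/-- The point `(a, b) ∈ ℝ²`. -/
def vec2 (a b : ℝ) : E2 := (WithLp.equiv 2 (Fin 2 → ℝ)).symm ![a, b]

/-- Gradient of the 2D Poisson field:
`∇Ψ_u(x) = −(1/2π) ∫ (x−y)/|x−y|² u(y) dy`. -/
def gradPsi (u : E2 → ℝ) (x : E2) : E2 :=
  -(1 / (2 * Real.pi)) • ∫ y : E2, u y • ((‖x - y‖ ^ 2)⁻¹ • (x - y))


open Set in
lemma aux_mp : MeasurePreserving (fun p : ℝ × ℝ => vec2 p.1 p.2) volume volume := by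
  have h1 := (MeasureTheory.volume_preserving_finTwoArrow ℝ).symm
  have h2 := PiLp.volume_preserving_toLp (Fin 2)
  have := h2.comp h1
  exact this

lemma aux_me : MeasurableEmbedding (fun p : ℝ × ℝ => vec2 p.1 p.2) := by
  have h1 := (MeasurableEquiv.finTwoArrow (α := ℝ)).symm.measurableEmbedding
  have h2 := (MeasurableEquiv.toLp 2 (Fin 2 → ℝ)).measurableEmbedding
  have := h2.comp h1
  exact this

lemma norm_vec2 (a b : ℝ) : ‖vec2 a b‖ = Real.sqrt (a ^ 2 + b ^ 2) := by
  simp [vec2, EuclideanSpace.norm_eq, Fin.sum_univ_two]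

lemma norm_polar (r t : ℝ) (hr : 0 ≤ r) : ‖vec2 (r * Real.cos t) (r * Real.sin t)‖ = r := by
  rw [norm_vec2, show (r * Real.cos t) ^ 2 + (r * Real.sin t) ^ 2 = r ^ 2 * (Real.cos t ^ 2 + Real.sin t ^ 2) by ring,
    Real.cos_sq_add_sin_sq, mul_one, Real.sqrt_sq hr]

lemma norm_vec2_sub (a b c d : ℝ) : ‖vec2 a b - vec2 c d‖ = Real.sqrt ((a - c) ^ 2 + (b - d) ^ 2) := by
  simp [vec2, EuclideanSpace.norm_eq, Fin.sum_univ_two]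

lemma cont_vec2 : Continuous (fun p : ℝ × ℝ => vec2 p.1 p.2) := by
  unfold vec2
  have : Continuous (fun p : ℝ × ℝ => ![p.1, p.2]) := by
    refine continuous_pi fun i => ?_
    fin_cases i <;> simp <;> fun_prop
  exact (PiLp.continuous_toLp 2 _).comp this

lemma cont_polar (γ : ℝ) : Continuous (fun t : ℝ => vec2 (γ * Real.cos t) (γ * Real.sin t)) :=
  cont_vec2.comp (by fun_prop : Continuous fun t : ℝ => (γ * Real.cos t, γ * Real.sin t))

lemma exists_polar (y : E2) : ∃ t : ℝ, y = vec2 (‖y‖ * Real.cos t) (‖y‖ * Real.sin t) := by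
  let z : ℂ := ⟨y 0, y 1⟩
  have hz : ‖z‖ = ‖y‖ := by
    simp [z, EuclideanSpace.norm_eq, Fin.sum_univ_two, Complex.norm_def, Complex.normSq_apply, pow_two]
  refine ⟨z.arg, ?_⟩
  have h1 := Complex.norm_mul_cos_arg z
  have h2 := Complex.norm_mul_sin_arg z
  rw [hz] at h1 h2
  rw [h1, h2]
  ext i
  fin_cases i <;> simp [vec2, z]

lemma polar_lintegral (f : E2 → ENNReal) :
    ∫⁻ y, f y = ∫⁻ p in Set.Ioi (0 : ℝ) ×ˢ Set.Ioo (-Real.pi) Real.pi,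
      ENNReal.ofReal p.1 * f (vec2 (p.1 * Real.cos p.2) (p.1 * Real.sin p.2)) := by
  rw [← aux_mp.lintegral_comp_emb aux_me, ← lintegral_comp_polarCoord_symm]
  rfl

lemma polar_integral (f : E2 → ℝ) :
    ∫ y, f y = ∫ p in Set.Ioi (0 : ℝ) ×ˢ Set.Ioo (-Real.pi) Real.pi,
      p.1 * f (vec2 (p.1 * Real.cos p.2) (p.1 * Real.sin p.2)) := by
  rw [← aux_mp.integral_comp aux_me, ← integral_comp_polarCoord_symm]
  rfl

lemma radial_lintegral (f : ℝ → ENNReal) (hf : Measurable f) :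
    ∫⁻ y : E2, f ‖y‖ = ENNReal.ofReal (2 * Real.pi) * ∫⁻ r in Set.Ioi (0 : ℝ), ENNReal.ofReal r * f r := by
  rw [polar_lintegral (fun y => f ‖y‖)]
  have : ∫⁻ p in Set.Ioi (0 : ℝ) ×ˢ Set.Ioo (-Real.pi) Real.pi,
      ENNReal.ofReal p.1 * f ‖vec2 (p.1 * Real.cos p.2) (p.1 * Real.sin p.2)‖
      = ∫⁻ p in Set.Ioi (0 : ℝ) ×ˢ Set.Ioo (-Real.pi) Real.pi,
      ENNReal.ofReal p.1 * f p.1 := by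
    refine setLIntegral_congr_fun (measurableSet_Ioi.prod measurableSet_Ioo) ?_
    intro p hp
    simp only
    rw [norm_polar _ _ (le_of_lt hp.1)]
  rw [this, Measure.volume_eq_prod, ← Measure.prod_restrict, lintegral_prod _ (by fun_prop)]
  simp only [lintegral_const, Measure.restrict_apply MeasurableSet.univ, Set.univ_inter, Real.volume_Ioo]
  rw [lintegral_mul_const _ (by fun_prop), mul_comm]
  congr 2
  ring

lemma radial_zero (u : E2 → ℝ)
    (h0 : ∀ γ : ℝ, 0 < γ → (∫ θ in (0 : ℝ)..(2 * Real.pi),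
              u (vec2 (γ * Real.cos θ) (γ * Real.sin θ))) = 0) (h : ℝ → ℝ) :
    ∫ y : E2, h ‖y‖ * u y = 0 := by
  rw [polar_integral (fun y => h ‖y‖ * u y)]
  by_cases hi : IntegrableOn (fun p : ℝ × ℝ => p.1 * (h ‖vec2 (p.1 * Real.cos p.2) (p.1 * Real.sin p.2)‖ *
      u (vec2 (p.1 * Real.cos p.2) (p.1 * Real.sin p.2)))) (Set.Ioi (0 : ℝ) ×ˢ Set.Ioo (-Real.pi) Real.pi) volume
  · rw [Measure.volume_eq_prod] at hi ⊢
    rw [setIntegral_prod _ hi]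
    refine setIntegral_eq_zero_of_forall_eq_zero ?_
    intro r hr
    have hr : 0 < r := hr
    simp only [norm_polar r _ hr.le]
    rw [integral_const_mul, integral_const_mul]
    have hper : Function.Periodic (fun t => u (vec2 (r * Real.cos t) (r * Real.sin t))) (2 * Real.pi) := by
      intro t; simp
    have := hper.intervalIntegral_add_eq (-Real.pi) 0
    rw [zero_add, h0 r hr, intervalIntegral.integral_of_le (by linarith [Real.pi_pos]),
      integral_Ioc_eq_integral_Ioo, show -Real.pi + 2 * Real.pi = Real.pi by ring] at this
    rw [this]; simp
  · exact integral_undef hi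

lemma ker_log_real (d m M : ℝ) (hd : 0 < d) (hM : 0 < M) (hm : 0 ≤ m) (hmM : m ≤ M)
    (h1 : M - m ≤ d) (h2 : d ≤ M + m) : |Real.log d - Real.log M| ≤ 2 * (m / d) := by
  have a1 : Real.log d - Real.log M ≤ d / M - 1 := by
    rw [← Real.log_div hd.ne' hM.ne']
    exact Real.log_le_sub_one_of_pos (by positivity)
  have a2 : Real.log M - Real.log d ≤ M / d - 1 := by
    rw [← Real.log_div hM.ne' hd.ne']
    exact Real.log_le_sub_one_of_pos (by positivity)
  have b1 : d / M - 1 ≤ 2 * (m / d) := by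
    have c1 : d / M - 1 ≤ m / M := by
      rw [div_sub_one hM.ne']
      gcongr; linarith
    have c2 : m / M ≤ 2 * (m / d) := by
      rw [← mul_div_assoc, div_le_div_iff₀ hM hd]
      nlinarith
    linarith
  have b2 : M / d - 1 ≤ m / d := by
    rw [div_sub_one hd.ne']
    gcongr; linarith
  have : 0 ≤ m / d := by positivity
  rw [abs_le]; constructor <;> linarith

lemma ker_log (x y : E2) (hx : x ≠ 0) (hxy : y ≠ x) :
    |Real.log ‖x - y‖ - Real.log (max ‖x‖ ‖y‖)| ≤ 2 * (min ‖x‖ ‖y‖ / ‖x - y‖) := by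
  have hx' : 0 < ‖x‖ := norm_pos_iff.mpr hx
  have e1 : max ‖x‖ ‖y‖ - min ‖x‖ ‖y‖ = |‖x‖ - ‖y‖| := max_sub_min_eq_abs' _ _
  have e2 : max ‖x‖ ‖y‖ + min ‖x‖ ‖y‖ = ‖x‖ + ‖y‖ := max_add_min _ _
  refine ker_log_real _ _ _ (norm_pos_iff.mpr (sub_ne_zero.mpr hxy.symm)) (lt_max_of_lt_left hx')
    (by positivity) min_le_max ?_ ?_
  · rw [e1]; exact abs_norm_sub_norm_le x y
  · rw [e2]; exact norm_sub_le x y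

lemma ker_grad (x y : E2) (hx : x ≠ 0) (hxy : y ≠ x) :
    ‖x‖ * ‖((‖x - y‖ ^ 2)⁻¹ • (x - y)) - (if ‖y‖ < ‖x‖ then (‖x‖ ^ 2)⁻¹ else 0) • x‖
      ≤ min ‖x‖ ‖y‖ / ‖x - y‖ := by
  have hx' : 0 < ‖x‖ := norm_pos_iff.mpr hx
  have hd : 0 < ‖x - y‖ := norm_pos_iff.mpr (sub_ne_zero.mpr hxy.symm)
  split_ifs with h
  · have := dist_div_norm_sq_smul (sub_ne_zero.mpr hxy.symm) hx 1
    rw [dist_eq_norm, dist_eq_norm] at this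
    simp only [one_div, inv_pow, one_pow] at this
    rw [this, min_eq_right h.le]
    rw [show x - y - x = -y by abel, norm_neg]
    apply le_of_eq
    field_simp
  · rw [zero_smul, sub_zero, norm_smul, min_eq_left (not_lt.mp h)]
    apply le_of_eq
    rw [norm_inv, norm_pow, norm_norm]
    field_simp

def BB (u : E2 → ℝ) (x : E2) : ENNReal :=
  ∫⁻ y : E2, ENNReal.ofReal (min ‖x‖ ‖y‖ / ‖x - y‖ * |u y|)

lemma ae_ne_pt (x : E2) : ∀ᵐ y : E2, y ≠ x := by
  simp [ae_iff]

lemma Psi_le (u : E2 → ℝ) (hu : Continuous u)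
    (h0 : ∀ γ : ℝ, 0 < γ → (∫ θ in (0 : ℝ)..(2 * Real.pi),
              u (vec2 (γ * Real.cos θ) (γ * Real.sin θ))) = 0) (x : E2) (hx : x ≠ 0) :
    ‖Psi u x‖ₑ ≤ BB u x := by
  by_cases hB : BB u x = ⊤
  · rw [hB]; exact le_top
  by_cases hi : Integrable (fun y : E2 => Real.log ‖x - y‖ * u y)
  swap
  · simp [Psi, integral_undef hi]
  have hle : ∀ᵐ y : E2, ‖(Real.log ‖x - y‖ - Real.log (max ‖x‖ ‖y‖)) * u y‖ₑ
      ≤ ENNReal.ofReal 2 * ENNReal.ofReal (min ‖x‖ ‖y‖ / ‖x - y‖ * |u y|) := by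
    filter_upwards [ae_ne_pt x] with y hy
    rw [← ENNReal.ofReal_mul (by norm_num), ← ofReal_norm]
    apply ENNReal.ofReal_le_ofReal
    rw [norm_mul, Real.norm_eq_abs, Real.norm_eq_abs, ← mul_assoc]
    exact mul_le_mul_of_nonneg_right (ker_log x y hx hy) (abs_nonneg _)
  have hle2 : ∫⁻ y : E2, ‖(Real.log ‖x - y‖ - Real.log (max ‖x‖ ‖y‖)) * u y‖ₑ
      ≤ ENNReal.ofReal 2 * BB u x := by
    refine (lintegral_mono_ae hle).trans (le_of_eq ?_)
    rw [lintegral_const_mul' _ _ ENNReal.ofReal_ne_top]; rfl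
  have hm : Measurable (fun y : E2 => (Real.log ‖x - y‖ - Real.log (max ‖x‖ ‖y‖)) * u y) := by
    have := hu.measurable
    fun_prop
  have hi2 : Integrable (fun y : E2 => (Real.log ‖x - y‖ - Real.log (max ‖x‖ ‖y‖)) * u y) := by
    refine ⟨hm.aestronglyMeasurable, ?_⟩
    exact hle2.trans_lt (ENNReal.mul_lt_top ENNReal.ofReal_lt_top (lt_top_iff_ne_top.mpr hB))
  have hz := radial_zero u h0 (fun r => Real.log (max ‖x‖ r))
  have heq : ∫ y : E2, Real.log ‖x - y‖ * u y
      = ∫ y : E2, (Real.log ‖x - y‖ - Real.log (max ‖x‖ ‖y‖)) * u y := by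
    have := integral_sub hi hi2
    rw [← sub_eq_zero, ← this, ← hz]
    congr 1; ext y; ring
  rw [Psi, heq, enorm_mul]
  have h3 : ‖-(1 / (2 * Real.pi))‖ₑ * ENNReal.ofReal 2 ≤ 1 := by
    rw [← ofReal_norm, ← ENNReal.ofReal_mul (norm_nonneg _), ← ENNReal.ofReal_one]
    apply ENNReal.ofReal_le_ofReal
    rw [norm_neg, Real.norm_eq_abs, abs_of_pos (by positivity)]
    have := Real.pi_gt_three
    rw [div_mul_eq_mul_div, div_le_one (by positivity)]; linarith
  calc _ ≤ ‖-(1 / (2 * Real.pi))‖ₑ * (ENNReal.ofReal 2 * BB u x) := by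
        gcongr
        exact (enorm_integral_le_lintegral_enorm _).trans hle2
    _ = (‖-(1 / (2 * Real.pi))‖ₑ * ENNReal.ofReal 2) * BB u x := by ring
    _ ≤ 1 * BB u x := by gcongr
    _ = _ := one_mul _

lemma grad_le (u : E2 → ℝ) (hu : Continuous u)
    (h0 : ∀ γ : ℝ, 0 < γ → (∫ θ in (0 : ℝ)..(2 * Real.pi),
              u (vec2 (γ * Real.cos θ) (γ * Real.sin θ))) = 0) (x : E2) (hx : x ≠ 0) :
    ENNReal.ofReal ‖x‖ * ‖gradPsi u x‖ₑ ≤ BB u x := by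
  by_cases hB : BB u x = ⊤
  · rw [hB]; exact le_top
  by_cases hi : Integrable (fun y : E2 => u y • ((‖x - y‖ ^ 2)⁻¹ • (x - y)))
  swap
  · simp [gradPsi, integral_undef hi]
  have hxp : 0 < ‖x‖ := norm_pos_iff.mpr hx
  let D : E2 → E2 := fun y => u y • (((‖x - y‖ ^ 2)⁻¹ • (x - y)) - (if ‖y‖ < ‖x‖ then (‖x‖ ^ 2)⁻¹ else 0) • x)
  have hle : ∀ᵐ y : E2, ENNReal.ofReal ‖x‖ * ‖D y‖ₑ
      ≤ ENNReal.ofReal (min ‖x‖ ‖y‖ / ‖x - y‖ * |u y|) := by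
    filter_upwards [ae_ne_pt x] with y hy
    rw [← ofReal_norm, ← ENNReal.ofReal_mul (norm_nonneg _)]
    apply ENNReal.ofReal_le_ofReal
    rw [norm_smul, Real.norm_eq_abs, mul_left_comm, mul_comm]
    exact mul_le_mul_of_nonneg_right (ker_grad x y hx hy) (abs_nonneg _)
  have hm : Measurable D := by
    have := hu.measurable
    refine this.smul (Measurable.sub ?_ ?_)
    · fun_prop
    · exact (Measurable.ite (measurableSet_lt measurable_norm measurable_const) measurable_const measurable_const).smul_const x
  have hle2 : ENNReal.ofReal ‖x‖ * ∫⁻ y : E2, ‖D y‖ₑ ≤ BB u x := by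
    rw [← lintegral_const_mul' _ _ ENNReal.ofReal_ne_top]
    exact lintegral_mono_ae hle
  have hi2 : Integrable D := by
    refine ⟨hm.aestronglyMeasurable, ?_⟩
    by_contra hc
    rw [HasFiniteIntegral, not_lt, top_le_iff] at hc
    rw [hc, ENNReal.mul_top (by simpa using hx)] at hle2
    exact hB (top_le_iff.mp hle2)
  have hz := radial_zero u h0 (fun r => if r < ‖x‖ then (‖x‖ ^ 2)⁻¹ else 0)
  have heq : ∫ y : E2, u y • ((‖x - y‖ ^ 2)⁻¹ • (x - y)) = ∫ y : E2, D y := by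
    have := integral_sub hi hi2
    rw [← sub_eq_zero, ← this]
    have h5 := integral_smul_const (μ := (volume : Measure E2)) (fun y : E2 => (if ‖y‖ < ‖x‖ then (‖x‖ ^ 2)⁻¹ else 0) * u y) x
    rw [hz, zero_smul] at h5
    rw [← h5]
    congr 1; ext1 y
    simp only [D]
    rw [smul_sub (u y), sub_sub_cancel, smul_smul, mul_comm]
  rw [gradPsi, heq, enorm_smul]
  have h3 : ‖-(1 / (2 * Real.pi))‖ₑ ≤ 1 := by
    rw [← ofReal_norm, ← ENNReal.ofReal_one]
    apply ENNReal.ofReal_le_ofReal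
    rw [norm_neg, Real.norm_eq_abs, abs_of_pos (by positivity)]
    have := Real.pi_gt_three
    rw [div_le_one (by positivity)]; linarith
  calc _ ≤ ENNReal.ofReal ‖x‖ * (1 * ∫⁻ y : E2, ‖D y‖ₑ) := by
        gcongr
        exact (enorm_integral_le_lintegral_enorm _)
    _ ≤ _ := by rw [one_mul]; exact hle2

lemma cs_lint (a p q : E2 → ℝ) (hp : Measurable p) (hq : Measurable q)
    (hp0 : ∀ y, 0 ≤ p y) (h : ∀ᵐ y, (a y) ^ 2 ≤ p y * q y) :
    (∫⁻ y, ENNReal.ofReal (a y)) ^ 2 ≤ (∫⁻ y, ENNReal.ofReal (p y)) * ∫⁻ y, ENNReal.ofReal (q y) := by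
  have h1 : ∫⁻ y, ENNReal.ofReal (a y) ≤
      ∫⁻ y, ((fun y => (ENNReal.ofReal (p y)) ^ (1 / 2 : ℝ)) * (fun y => (ENNReal.ofReal (q y)) ^ (1 / 2 : ℝ))) y := by
    refine lintegral_mono_ae ?_
    filter_upwards [h] with y hy
    simp only [Pi.mul_apply]
    rw [← ENNReal.mul_rpow_of_nonneg _ _ (by norm_num), ← ENNReal.ofReal_mul (hp0 y)]
    rw [ENNReal.ofReal_rpow_of_nonneg ((sq_nonneg _).trans hy) (by norm_num), ← Real.sqrt_eq_rpow]
    exact ENNReal.ofReal_le_ofReal (Real.le_sqrt_of_sq_le hy)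
  have h2 := ENNReal.lintegral_mul_le_Lp_mul_Lq (volume : Measure E2) Real.HolderConjugate.two_two
    (f := fun y => (ENNReal.ofReal (p y)) ^ (1 / 2 : ℝ)) (g := fun y => (ENNReal.ofReal (q y)) ^ (1 / 2 : ℝ))
    (by fun_prop) (by fun_prop)
  have e : ∀ z : ENNReal, (z ^ (1 / 2 : ℝ)) ^ (2 : ℝ) = z := by
    intro z; rw [← ENNReal.rpow_mul]; norm_num
  simp only [e] at h2
  have h3 := h1.trans h2
  calc _ ≤ _ := pow_le_pow_left' h3 2
    _ = _ := by
      rw [mul_pow, ← ENNReal.rpow_natCast, ← ENNReal.rpow_natCast]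
      simp only [Nat.cast_ofNat, e]

def gs (t : ℝ) : ℝ := Real.sqrt (1 / |Real.sin t|)

lemma gs_per : Function.Periodic gs Real.pi := by
  intro t; simp [gs, Real.sin_add_pi]

lemma gs_per2 : Function.Periodic gs (2 * Real.pi) := by
  intro t; simp [gs]

lemma sqrt_inv_int (b : ℝ) : IntervalIntegrable (fun t : ℝ => t ^ (-(1 / 2) : ℝ)) volume 0 b :=
  intervalIntegral.intervalIntegrable_rpow' (by norm_num)

lemma gs_bound (t : ℝ) (h0 : 0 < t) (h1 : t ≤ Real.pi / 2) :
    gs t ≤ Real.sqrt (Real.pi / 2) * t ^ (-(1 / 2) : ℝ) := by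
  have h := Real.mul_le_sin h0.le h1
  have hpi := Real.pi_pos
  rw [Real.rpow_neg h0.le, ← Real.sqrt_eq_rpow, ← Real.sqrt_inv, ← Real.sqrt_mul (by positivity), gs]
  apply Real.sqrt_le_sqrt
  have hp : 0 < 2 / Real.pi * t := by positivity
  rw [abs_of_pos (lt_of_lt_of_le hp h)]
  calc 1 / Real.sin t ≤ 1 / (2 / Real.pi * t) := by gcongr
    _ = _ := by field_simp

lemma gs_meas : Measurable gs := by unfold gs; fun_prop

lemma gs_int0 : IntervalIntegrable gs volume 0 (0 + Real.pi) := by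
  have hpi := Real.pi_pos
  have i1 := sqrt_inv_int Real.pi
  have i2 := (sqrt_inv_int Real.pi).comp_sub_left Real.pi
  simp only [sub_zero, sub_self] at i2
  have i3 := (i1.add i2.symm).const_mul (Real.sqrt (Real.pi / 2))
  rw [zero_add]
  refine i3.mono_fun gs_meas.aestronglyMeasurable ?_
  have : ∀ᵐ t : ℝ, t ≠ Real.pi := by simp [ae_iff]
  rw [Filter.EventuallyLE, ae_restrict_iff' measurableSet_uIoc]
  filter_upwards [this] with t ht hmem
  rw [Set.uIoc_of_le hpi.le] at hmem
  have hlt : t < Real.pi := lt_of_le_of_ne hmem.2 ht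
  have n1 : 0 ≤ t ^ (-(1 / 2) : ℝ) := Real.rpow_nonneg hmem.1.le _
  have n2 : 0 ≤ (Real.pi - t) ^ (-(1 / 2) : ℝ) := Real.rpow_nonneg (by linarith) _
  rw [Real.norm_of_nonneg (show 0 ≤ gs t from Real.sqrt_nonneg _), Real.norm_of_nonneg (by positivity)]
  rcases le_total t (Real.pi / 2) with h | h
  · refine (gs_bound t hmem.1 h).trans ?_
    gcongr; linarith
  · have := gs_bound (Real.pi - t) (by linarith) (by linarith)
    have e : gs (Real.pi - t) = gs t := by simp [gs, Real.sin_pi_sub]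
    rw [e] at this
    refine this.trans ?_
    gcongr; linarith

lemma gs_int (a b : ℝ) : IntervalIntegrable gs volume a b :=
  gs_per.intervalIntegrable Real.pi_pos.ne' gs_int0 a b

def KK : ℝ := ∫ t in (0 : ℝ)..(2 * Real.pi), gs t

lemma KK_nonneg : 0 ≤ KK :=
  intervalIntegral.integral_nonneg (by linarith [Real.pi_pos]) (fun t _ => Real.sqrt_nonneg _)

lemma gs_shift (φ : ℝ) : ∫⁻ θ in Set.Ioc 0 (2 * Real.pi), ENNReal.ofReal (gs (θ - φ)) = ENNReal.ofReal KK := by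
  have hpi := Real.pi_pos
  have hi : IntervalIntegrable (fun θ => gs (θ - φ)) volume 0 (2 * Real.pi) := by
    have := (gs_int (0 - φ) (2 * Real.pi - φ)).comp_sub_right φ
    simpa using this
  rw [← ofReal_integral_eq_lintegral_ofReal ((intervalIntegrable_iff_integrableOn_Ioc_of_le (by linarith)).mp hi)
    (Filter.Eventually.of_forall fun t => Real.sqrt_nonneg _)]
  congr 1
  rw [← intervalIntegral.integral_of_le (by linarith), intervalIntegral.integral_comp_sub_right, KK]
  have := gs_per2.intervalIntegral_add_eq (0 - φ) 0
  rw [zero_add] at this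
  rw [← this]; congr 1; ring

lemma dist_ge (γ r t φ : ℝ) :
    max γ r * |Real.sin (t - φ)| ≤
     ‖vec2 (γ * Real.cos t) (γ * Real.sin t) - vec2 (r * Real.cos φ) (r * Real.sin φ)‖ := by
  rw [norm_vec2_sub]
  apply Real.le_sqrt_of_sq_le
  rw [mul_pow, sq_abs]
  have e : (γ * Real.cos t - r * Real.cos φ) ^ 2 + (γ * Real.sin t - r * Real.sin φ) ^ 2
      = γ ^ 2 + r ^ 2 - 2 * γ * r * Real.cos (t - φ) := by
    rw [Real.cos_sub]
    linear_combination γ ^ 2 * Real.sin_sq_add_cos_sq t + r ^ 2 * Real.sin_sq_add_cos_sq φ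
  rw [e, Real.sin_sq]
  rcases max_cases γ r with ⟨h, _⟩ | ⟨h, _⟩ <;> rw [h]
  · nlinarith [sq_nonneg (r - γ * Real.cos (t - φ))]
  · nlinarith [sq_nonneg (γ - r * Real.cos (t - φ))]

lemma q_int (γ : ℝ) (hγ : 0 < γ) (y : E2) :
    ∫⁻ t in Set.Ioc 0 (2 * Real.pi), ENNReal.ofReal
      (Real.sqrt (max γ ‖y‖ / ‖vec2 (γ * Real.cos t) (γ * Real.sin t) - y‖)) ≤ ENNReal.ofReal KK := by
  obtain ⟨φ, hφ⟩ := exists_polar y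
  rw [← gs_shift φ]
  refine lintegral_mono_ae (ae_restrict_of_ae ?_)
  have hc : (Set.range (fun n : ℤ => (n : ℝ) * Real.pi + φ)).Countable := Set.countable_range _
  filter_upwards [hc.ae_notMem volume] with t ht
  have hs : 0 < |Real.sin (t - φ)| := by
    rw [abs_pos]
    intro h
    obtain ⟨n, hn⟩ := Real.sin_eq_zero_iff.mp h
    exact ht ⟨n, by simp only; linarith⟩
  apply ENNReal.ofReal_le_ofReal
  apply Real.sqrt_le_sqrt
  have h1 := dist_ge γ ‖y‖ t φ
  rw [← hφ] at h1
  have hM : 0 < max γ ‖y‖ := lt_max_of_lt_left hγ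
  rw [div_le_div_iff₀ (lt_of_lt_of_le (by positivity) h1) hs, one_mul]
  exact h1

lemma rad_bound (P F : ℝ → ℝ) (S : Set ℝ) (hS : MeasurableSet S) (hP : Measurable P)
    (h : ∀ r, 0 < r → r ∈ S → r * P r ≤ F r) (h' : ∀ r, 0 < r → r ∉ S → P r ≤ 0)
    (hF : IntegrableOn F S) (hF0 : ∀ r ∈ S, 0 ≤ F r) :
    ∫⁻ y : E2, ENNReal.ofReal (P ‖y‖) ≤ ENNReal.ofReal (2 * Real.pi * ∫ r in S, F r) := by
  rw [radial_lintegral (fun r => ENNReal.ofReal (P r)) (by fun_prop),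
    ENNReal.ofReal_mul (p := 2 * Real.pi) (by positivity)]
  refine mul_le_mul_right ?_ _
  rw [ofReal_integral_eq_lintegral_ofReal hF ((ae_restrict_iff' hS).mpr (Filter.Eventually.of_forall hF0)),
    ← lintegral_indicator hS]
  refine (setLIntegral_mono' measurableSet_Ioi ?_).trans (setLIntegral_le_lintegral _ _)
  intro r hr
  have hr : 0 < r := hr
  rw [← ENNReal.ofReal_mul hr.le]
  by_cases hrS : r ∈ S
  · rw [Set.indicator_of_mem hrS]
    exact ENNReal.ofReal_le_ofReal (h r hr hrS)
  · rw [Set.indicator_of_notMem hrS, nonpos_iff_eq_zero, ENNReal.ofReal_eq_zero]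
    exact mul_nonpos_of_nonneg_of_nonpos hr.le (h' r hr hrS)

lemma Whalf (α γ z : ℝ) (h0 : 0 < α) (h2 : α < 2) (hγ : 0 < γ) (hz : (1 + γ) / 2 ≤ z) :
    z ^ (-(2 * α)) ≤ 16 * (1 + γ) ^ (-(2 * α)) := by
  have h1 : z ^ (-(2 * α)) ≤ ((1 + γ) / 2) ^ (-(2 * α)) :=
    Real.rpow_le_rpow_of_nonpos (by linarith) hz (by linarith)
  refine h1.trans ?_
  rw [Real.div_rpow (by linarith) (by norm_num), Real.rpow_neg (by norm_num : (0:ℝ) ≤ 2), div_inv_eq_mul, mul_comm]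
  have : (2 : ℝ) ^ (2 * α) ≤ 2 ^ (4 : ℝ) := Real.rpow_le_rpow_of_exponent_le (by norm_num) (by linarith)
  have e : (2 : ℝ) ^ (4 : ℝ) = 16 := by norm_num
  have : 0 ≤ (1 + γ) ^ (-(2 * α)) := Real.rpow_nonneg (by linarith) _
  nlinarith

def P1 (α γ r : ℝ) : ℝ := if r ≤ γ then 8 * (r ^ 2 / γ ^ 2) * (1 + r) ^ (-(2 * α)) else 0
def P2 (α γ d : ℝ) : ℝ := if d ≤ 3 * γ then 16 * (1 + γ) ^ (-(2 * α)) * ((γ / d) ^ 2 * Real.sqrt (d / γ)) else 0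
def P3 (α γ r : ℝ) : ℝ := if γ < r ∧ r ≤ 1 then 8 * (γ ^ 2 / r ^ 2) * (1 + r) ^ (-(2 * α)) else 0
def P4 (α γ r : ℝ) : ℝ := if max γ 1 < r then 8 * (γ ^ 2 / r ^ 2) * (1 + r) ^ (-(2 * α)) else 0

lemma P1m (α γ : ℝ) : Measurable (P1 α γ) := by
  unfold P1
  exact Measurable.ite measurableSet_Iic (by fun_prop) measurable_const
lemma P2m (α γ : ℝ) : Measurable (P2 α γ) := by
  unfold P2
  exact Measurable.ite measurableSet_Iic (by fun_prop) measurable_const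
lemma P3m (α γ : ℝ) : Measurable (P3 α γ) := by
  unfold P3
  exact Measurable.ite measurableSet_Ioc (by fun_prop) measurable_const
lemma P4m (α γ : ℝ) : Measurable (P4 α γ) := by
  unfold P4
  exact Measurable.ite measurableSet_Ioi (by fun_prop) measurable_const

lemma P1int (α γ : ℝ) (h0 : 0 < α) (h2 : α < 2) (hγ : 0 < γ) :
    ∫⁻ y : E2, ENNReal.ofReal (P1 α γ ‖y‖) ≤
      ENNReal.ofReal (2 * Real.pi * (8 / (4 - 2 * α)) * (γ ^ 2 * (1 + γ) ^ (-(2 * α)))) := by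
  have hint := intervalIntegral.intervalIntegrable_rpow' (a := 0) (b := γ) (r := 3 - 2 * α) (by linarith)
  have hint' := (intervalIntegrable_iff_integrableOn_Ioc_of_le hγ.le).mp hint
  have hw : 0 < (1 + γ) ^ (-(2 * α)) := Real.rpow_pos_of_pos (by linarith) _
  refine (rad_bound (P1 α γ) (fun r => (8 / γ ^ 2 * (γ ^ (2 * α) * (1 + γ) ^ (-(2 * α)))) * r ^ (3 - 2 * α))
    (Set.Ioc 0 γ) measurableSet_Ioc (P1m α γ) ?_ ?_ (hint'.const_mul _) ?_).trans (ENNReal.ofReal_le_ofReal (le_of_eq ?_))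
  · intro r hr hrS
    rw [P1, if_pos hrS.2]
    have key : r ^ (2 * α) * (1 + r) ^ (-(2 * α)) ≤ γ ^ (2 * α) * (1 + γ) ^ (-(2 * α)) := by
      rw [Real.rpow_neg (by linarith), Real.rpow_neg (by linarith), ← div_eq_mul_inv, ← div_eq_mul_inv,
        ← Real.div_rpow (by linarith) (by linarith), ← Real.div_rpow (by linarith) (by linarith)]
      apply Real.rpow_le_rpow (by positivity) _ (by linarith)
      rw [div_le_div_iff₀ (by linarith) (by linarith)]
      nlinarith [hrS.2]
    have e : r ^ 3 = r ^ (2 * α) * r ^ (3 - 2 * α) := by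
      rw [← Real.rpow_add hr, ← Real.rpow_natCast]; congr 1; push_cast; ring
    calc r * (8 * (r ^ 2 / γ ^ 2) * (1 + r) ^ (-(2 * α))) = 8 / γ ^ 2 * (r ^ 3 * (1 + r) ^ (-(2 * α))) := by ring
      _ = 8 / γ ^ 2 * (r ^ (2 * α) * (1 + r) ^ (-(2 * α))) * r ^ (3 - 2 * α) := by rw [e]; ring
      _ ≤ _ := by gcongr
  · intro r hr hrS
    rw [P1, if_neg]
    intro h; exact hrS ⟨hr, h⟩
  · intro r hr
    have := hr.1
    positivity
  · rw [integral_const_mul, ← intervalIntegral.integral_of_le hγ.le, integral_rpow (Or.inl (by linarith)),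
      Real.zero_rpow (by linarith), sub_zero, show 3 - 2 * α + 1 = 4 - 2 * α by ring]
    have e : γ ^ (2 * α) * γ ^ (4 - 2 * α) = γ ^ 4 := by
      rw [← Real.rpow_add hγ, ← Real.rpow_natCast]; congr 1; push_cast; ring
    have h4 : 4 - 2 * α ≠ 0 := by linarith
    calc _ = 2 * Real.pi * (8 / γ ^ 2 * (1 + γ) ^ (-(2 * α)) * (γ ^ (2 * α) * γ ^ (4 - 2 * α)) / (4 - 2 * α)) := by ring
      _ = _ := by rw [e]; field_simp

lemma P2int (α γ : ℝ) (hγ : 0 < γ) (x : E2) :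
    ∫⁻ y : E2, ENNReal.ofReal (P2 α γ ‖x - y‖) ≤
      ENNReal.ofReal (2 * Real.pi * 64 * (γ ^ 2 * (1 + γ) ^ (-(2 * α)))) := by
  rw [lintegral_sub_left_eq_self (fun y : E2 => ENNReal.ofReal (P2 α γ ‖y‖)) x]
  have hint := sqrt_inv_int (3 * γ)
  have hint' := (intervalIntegrable_iff_integrableOn_Ioc_of_le (by linarith)).mp hint
  have hw : 0 < (1 + γ) ^ (-(2 * α)) := Real.rpow_pos_of_pos (by linarith) _
  have hsg : 0 < Real.sqrt γ := Real.sqrt_pos.mpr hγ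
  refine (rad_bound (P2 α γ) (fun r => (16 * (1 + γ) ^ (-(2 * α)) * (γ ^ 2 / Real.sqrt γ)) * r ^ (-(1 / 2) : ℝ))
    (Set.Ioc 0 (3 * γ)) measurableSet_Ioc (P2m α γ) ?_ ?_ (hint'.const_mul _) ?_).trans (ENNReal.ofReal_le_ofReal ?_)
  · intro r hr hrS
    rw [P2, if_pos hrS.2]
    apply le_of_eq
    rw [Real.sqrt_div hr.le, Real.rpow_neg hr.le, ← Real.sqrt_eq_rpow]
    have hsr : 0 < Real.sqrt r := Real.sqrt_pos.mpr hr
    have := Real.sq_sqrt hr.le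
    field_simp
    linear_combination this
  · intro r hr hrS
    rw [P2, if_neg]
    intro h; exact hrS ⟨hr, h⟩
  · intro r hr
    have := hr.1
    positivity
  · rw [integral_const_mul, ← intervalIntegral.integral_of_le (by linarith), integral_rpow (Or.inl (by norm_num)),
      Real.zero_rpow (by norm_num), sub_zero, show -(1 / 2 : ℝ) + 1 = 1 / 2 by norm_num, ← Real.sqrt_eq_rpow,
      Real.sqrt_mul (by norm_num)]
    have h3 : Real.sqrt 3 ≤ 2 := by
      rw [Real.sqrt_le_left (by norm_num)]; norm_num
    calc _ = 2 * Real.pi * (32 * Real.sqrt 3) * (γ ^ 2 * (1 + γ) ^ (-(2 * α))) := by field_simp; ring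
      _ ≤ _ := by gcongr; linarith

lemma P3int (α γ : ℝ) (h0 : 0 < α) (h2 : α < 2) (hγ : 0 < γ) :
    ∫⁻ y : E2, ENNReal.ofReal (P3 α γ ‖y‖) ≤
      ENNReal.ofReal (2 * Real.pi * 128 * (γ ^ 2 * (1 + γ) ^ (-(2 * α))) * (if γ ≤ 1 then |Real.log γ| else 0)) := by
  have hw : 0 < (1 + γ) ^ (-(2 * α)) := Real.rpow_pos_of_pos (by linarith) _
  split_ifs with h1
  · have hint : IntervalIntegrable (fun r : ℝ => r⁻¹) volume γ 1 := by
      apply intervalIntegral.intervalIntegrable_inv _ continuousOn_id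
      intro r hr
      rw [Set.uIcc_of_le h1] at hr
      exact (lt_of_lt_of_le hγ hr.1).ne'
    have hint' := (intervalIntegrable_iff_integrableOn_Ioc_of_le h1).mp hint
    refine (rad_bound (P3 α γ) (fun r => (8 * γ ^ 2) * r⁻¹)
      (Set.Ioc γ 1) measurableSet_Ioc (P3m α γ) ?_ ?_ (hint'.const_mul _) ?_).trans (ENNReal.ofReal_le_ofReal ?_)
    · intro r hr hrS
      rw [P3, if_pos (show γ < r ∧ r ≤ 1 from hrS)]
      have : (1 + r) ^ (-(2 * α)) ≤ 1 := Real.rpow_le_one_of_one_le_of_nonpos (by linarith) (by linarith)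
      calc r * (8 * (γ ^ 2 / r ^ 2) * (1 + r) ^ (-(2 * α))) = 8 * γ ^ 2 * r⁻¹ * (1 + r) ^ (-(2 * α)) := by field_simp
        _ ≤ 8 * γ ^ 2 * r⁻¹ * 1 := by gcongr
        _ = _ := mul_one _
    · intro r hr hrS
      rw [P3, if_neg]
      intro h; exact hrS h
    · intro r hr
      have : 0 < r := hγ.trans hr.1
      positivity
    · rw [integral_const_mul, ← intervalIntegral.integral_of_le h1, integral_inv_of_pos hγ one_pos, one_div, Real.log_inv,
        abs_of_nonpos (Real.log_nonpos hγ.le h1)]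
      have hl : 0 ≤ -Real.log γ := by linarith [Real.log_nonpos hγ.le h1]
      have h16 := Whalf α γ 1 h0 h2 hγ (by linarith)
      rw [Real.one_rpow] at h16
      calc _ = 2 * Real.pi * 8 * γ ^ 2 * (-Real.log γ) * 1 := by ring
        _ ≤ 2 * Real.pi * 8 * γ ^ 2 * (-Real.log γ) * (16 * (1 + γ) ^ (-(2 * α))) := by gcongr
        _ = _ := by ring
  · have : ∀ r, P3 α γ r = 0 := by
      intro r; rw [P3, if_neg]; intro h; linarith [h.1, h.2]
    simp [this]

lemma P4int (α γ : ℝ) (h0 : 0 < α) (h2 : α < 2) (hγ : 0 < γ) :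
    ∫⁻ y : E2, ENNReal.ofReal (P4 α γ ‖y‖) ≤
      ENNReal.ofReal (2 * Real.pi * (64 / α) * (γ ^ 2 * (1 + γ) ^ (-(2 * α)))) := by
  have hm : 0 < max γ 1 := lt_max_of_lt_left hγ
  have hint' := integrableOn_Ioi_rpow_of_lt (a := -1 - 2 * α) (by linarith) hm
  refine (rad_bound (P4 α γ) (fun r => (8 * γ ^ 2) * r ^ (-1 - 2 * α))
    (Set.Ioi (max γ 1)) measurableSet_Ioi (P4m α γ) ?_ ?_ (hint'.const_mul _) ?_).trans (ENNReal.ofReal_le_ofReal ?_)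
  · intro r hr hrS
    rw [P4, if_pos (show max γ 1 < r from hrS)]
    have : (1 + r) ^ (-(2 * α)) ≤ r ^ (-(2 * α)) := Real.rpow_le_rpow_of_nonpos hr (by linarith) (by linarith)
    calc r * (8 * (γ ^ 2 / r ^ 2) * (1 + r) ^ (-(2 * α))) = 8 * γ ^ 2 * (r⁻¹ * (1 + r) ^ (-(2 * α))) := by field_simp
      _ ≤ 8 * γ ^ 2 * (r⁻¹ * r ^ (-(2 * α))) := by gcongr
      _ = _ := by
        rw [← Real.rpow_neg_one r, ← Real.rpow_add hr]; congr 2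
  · intro r hr hrS
    rw [P4, if_neg]
    intro h; exact hrS h
  · intro r hr
    have : 0 < r := hm.trans hr
    positivity
  · rw [integral_const_mul, integral_Ioi_rpow_of_lt (by linarith) hm, show -1 - 2 * α + 1 = -(2 * α) by ring, neg_div_neg_eq]
    have h16 := Whalf α γ (max γ 1) h0 h2 hγ (by linarith [le_max_left γ 1, le_max_right γ 1])
    calc _ ≤ 2 * Real.pi * (8 * γ ^ 2 * (16 * (1 + γ) ^ (-(2 * α)) / (2 * α))) := by gcongr
      _ = _ := by field_simp; ring

def pp (α : ℝ) (x y : E2) : ℝ :=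
  (min ‖x‖ ‖y‖ / ‖x - y‖) ^ 2 * (1 + ‖y‖) ^ (-(2 * α)) * Real.sqrt (‖x - y‖ / max ‖x‖ ‖y‖)

lemma pp_real (α γ r d : ℝ) (h0 : 0 < α) (h2 : α < 2) (hγ : 0 < γ) (hr : 0 ≤ r) (hd : 0 < d)
    (hd1 : γ - r ≤ d) (hd2 : r - γ ≤ d) (hd3 : d ≤ γ + r) :
    (min γ r / d) ^ 2 * (1 + r) ^ (-(2 * α)) * Real.sqrt (d / max γ r)
      ≤ P1 α γ r + P2 α γ d + P3 α γ r + P4 α γ r := by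
  have hw : 0 < (1 + γ) ^ (-(2 * α)) := Real.rpow_pos_of_pos (by linarith) _
  have hw' : 0 < (1 + r) ^ (-(2 * α)) := Real.rpow_pos_of_pos (by linarith) _
  have n1 : 0 ≤ P1 α γ r := by unfold P1; split_ifs <;> positivity
  have n2 : 0 ≤ P2 α γ d := by unfold P2; split_ifs <;> positivity
  have n3 : 0 ≤ P3 α γ r := by unfold P3; split_ifs <;> positivity
  have n4 : 0 ≤ P4 α γ r := by unfold P4; split_ifs <;> positivity
  have hM : 0 < max γ r := lt_max_of_lt_left hγ
  have hs : Real.sqrt (d / max γ r) ≤ 2 := by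
    rw [Real.sqrt_le_left (by norm_num), div_le_iff₀ hM]
    have := le_max_left γ r
    have := le_max_right γ r
    linarith
  rcases le_or_gt r (γ / 2) with c | c
  · suffices (min γ r / d) ^ 2 * (1 + r) ^ (-(2 * α)) * Real.sqrt (d / max γ r) ≤ P1 α γ r by linarith
    rw [P1, if_pos (by linarith), min_eq_right (by linarith)]
    have hq : r / d ≤ r / (γ / 2) := by gcongr; linarith
    calc _ ≤ (r / (γ / 2)) ^ 2 * (1 + r) ^ (-(2 * α)) * 2 := by gcongr
      _ = _ := by field_simp; norm_num
  rcases lt_or_ge r (2 * γ) with c' | c'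
  · suffices (min γ r / d) ^ 2 * (1 + r) ^ (-(2 * α)) * Real.sqrt (d / max γ r) ≤ P2 α γ d by linarith
    rw [P2, if_pos (by linarith)]
    have hW := Whalf α γ (1 + r) h0 h2 hγ (by linarith)
    have hmn : 0 ≤ min γ r := le_min hγ.le hr
    calc _ ≤ (γ / d) ^ 2 * (16 * (1 + γ) ^ (-(2 * α))) * Real.sqrt (d / γ) := by
          gcongr
          · exact min_le_left _ _
          · exact le_max_left _ _
      _ = _ := by ring
  · have hrp : 0 < r := by linarith
    have hq : γ / d ≤ γ / (r / 2) := by gcongr; linarith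
    have key : (min γ r / d) ^ 2 * (1 + r) ^ (-(2 * α)) * Real.sqrt (d / max γ r) ≤
        8 * (γ ^ 2 / r ^ 2) * (1 + r) ^ (-(2 * α)) := by
      rw [min_eq_left (by linarith)]
      calc _ ≤ (γ / (r / 2)) ^ 2 * (1 + r) ^ (-(2 * α)) * 2 := by gcongr
        _ = _ := by field_simp; norm_num
    rcases le_or_gt r 1 with c1 | c1
    · have : P3 α γ r = 8 * (γ ^ 2 / r ^ 2) * (1 + r) ^ (-(2 * α)) := by
        rw [P3, if_pos ⟨by linarith, c1⟩]
      linarith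
    · have : P4 α γ r = 8 * (γ ^ 2 / r ^ 2) * (1 + r) ^ (-(2 * α)) := by
        rw [P4, if_pos (max_lt (by linarith) c1)]
      linarith

def CQ (α : ℝ) : ℝ := 2 * Real.pi * (8 / (4 - 2 * α)) + 2 * Real.pi * 64 + 2 * Real.pi * 128 + 2 * Real.pi * (64 / α)

lemma CQ_pos (α : ℝ) (h0 : 0 < α) (h2 : α < 2) : 0 < CQ α := by
  have : 0 < 4 - 2 * α := by linarith
  unfold CQ; positivity

lemma pp_int (α : ℝ) (h0 : 0 < α) (h2 : α < 2) (γ : ℝ) (hγ : 0 < γ) (x : E2) (hx : ‖x‖ = γ) :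
    ∫⁻ y, ENNReal.ofReal (pp α x y) ≤
      ENNReal.ofReal (CQ α * (γ ^ 2 * (1 + γ) ^ (-(2 * α)) * (1 + if γ ≤ 1 then |Real.log γ| else 0))) := by
  have hw : 0 < (1 + γ) ^ (-(2 * α)) := Real.rpow_pos_of_pos (by linarith) _
  have h4 : 0 < 4 - 2 * α := by linarith
  have hL : 0 ≤ (if γ ≤ 1 then |Real.log γ| else 0) := by split_ifs <;> positivity
  have hm1 := P1m α γ
  have hm2 := P2m α γ
  have hm3 := P3m α γ
  have hm4 := P4m α γ
  have hle : ∫⁻ y, ENNReal.ofReal (pp α x y) ≤ ∫⁻ y : E2, (ENNReal.ofReal (P1 α γ ‖y‖) +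
      ENNReal.ofReal (P2 α γ ‖x - y‖) + ENNReal.ofReal (P3 α γ ‖y‖) + ENNReal.ofReal (P4 α γ ‖y‖)) := by
    refine lintegral_mono_ae ?_
    filter_upwards [ae_ne_pt x] with y hy
    have hd : 0 < ‖x - y‖ := norm_pos_iff.mpr (sub_ne_zero.mpr hy.symm)
    have k := pp_real α γ ‖y‖ ‖x - y‖ h0 h2 hγ (norm_nonneg _) hd (by rw [← hx]; exact norm_sub_norm_le x y)
      (by rw [← hx, norm_sub_rev]; exact norm_sub_norm_le y x) (by rw [← hx]; exact norm_sub_le x y)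
    rw [pp, hx]
    refine (ENNReal.ofReal_le_ofReal k).trans ?_
    refine ENNReal.ofReal_add_le.trans (add_le_add_left ?_ _)
    refine ENNReal.ofReal_add_le.trans (add_le_add_left ?_ _)
    exact ENNReal.ofReal_add_le
  refine hle.trans ?_
  rw [lintegral_add_left (by fun_prop), lintegral_add_left (by fun_prop), lintegral_add_left (by fun_prop)]
  refine (add_le_add (add_le_add (add_le_add (P1int α γ h0 h2 hγ) (P2int α γ hγ x)) (P3int α γ h0 h2 hγ))
    (P4int α γ h0 h2 hγ)).trans ?_
  have hpi := Real.pi_pos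
  rw [← ENNReal.ofReal_add (by positivity) (by positivity), ← ENNReal.ofReal_add (by positivity) (by positivity),
    ← ENNReal.ofReal_add (by positivity) (by positivity)]
  apply ENNReal.ofReal_le_ofReal
  set L := (if γ ≤ 1 then |Real.log γ| else 0)
  set V := γ ^ 2 * (1 + γ) ^ (-(2 * α))
  have hV : 0 < V := by positivity
  have hVL : 0 ≤ V * L := by positivity
  have e1 : 0 ≤ 2 * Real.pi * (8 / (4 - 2 * α)) * (V * L) := by positivity
  have e2 : 0 ≤ 2 * Real.pi * 64 * (V * L) := by positivity
  have e3 : 0 ≤ 2 * Real.pi * 128 * V := by positivity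
  have e4 : 0 ≤ 2 * Real.pi * (64 / α) * (V * L) := by positivity
  unfold CQ
  linarith

lemma BB_sq (α : ℝ) (u : E2 → ℝ) (hu : Continuous u) (x : E2) (hx : x ≠ 0) :
    BB u x ^ 2 ≤ (∫⁻ y, ENNReal.ofReal (pp α x y)) *
      ∫⁻ y, ENNReal.ofReal ((u y) ^ 2 * (1 + ‖y‖) ^ (2 * α) * Real.sqrt (max ‖x‖ ‖y‖ / ‖x - y‖)) := by
  have := hu.measurable
  refine cs_lint _ _ _ (by unfold pp; fun_prop) (by fun_prop) ?_ ?_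
  · intro y; unfold pp; positivity
  · filter_upwards [ae_ne_pt x] with y hy
    have hd : 0 < ‖x - y‖ := norm_pos_iff.mpr (sub_ne_zero.mpr hy.symm)
    have hM : 0 < max ‖x‖ ‖y‖ := lt_max_of_lt_left (norm_pos_iff.mpr hx)
    have hb : 0 < 1 + ‖y‖ := by positivity
    apply le_of_eq
    have e1 : (1 + ‖y‖) ^ (-(2 * α)) * (1 + ‖y‖) ^ (2 * α) = 1 := by
      rw [← Real.rpow_add hb]; simp
    have e2 : Real.sqrt (‖x - y‖ / max ‖x‖ ‖y‖) * Real.sqrt (max ‖x‖ ‖y‖ / ‖x - y‖) = 1 := by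
      rw [← Real.sqrt_mul (by positivity), div_mul_div_cancel₀ hM.ne', div_self hd.ne', Real.sqrt_one]
    rw [pp, mul_pow, sq_abs]
    calc _ = (min ‖x‖ ‖y‖ / ‖x - y‖) ^ 2 * u y ^ 2 * ((1 + ‖y‖) ^ (-(2 * α)) * (1 + ‖y‖) ^ (2 * α)) *
          (Real.sqrt (‖x - y‖ / max ‖x‖ ‖y‖) * Real.sqrt (max ‖x‖ ‖y‖ / ‖x - y‖)) := by rw [e1, e2]; ring
      _ = _ := by ring

/-- angular `L²` estimates of the Poisson field of a function with
vanishing angular average. -/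
theorem stmt17 (α : ℝ) (hα : α ∈ Set.Ioo (0 : ℝ) 2) :
    ∃ Cα : ℝ, 0 < Cα ∧
      ∀ u : E2 → ℝ, Continuous u →
        Integrable (fun y : E2 => (u y) ^ 2 * (1 + ‖y‖) ^ (2 * α)) →
        (∀ γ : ℝ, 0 < γ →
          (∫ θ in (0 : ℝ)..(2 * Real.pi),
              u (vec2 (γ * Real.cos θ) (γ * Real.sin θ))) = 0) →
        ∀ γ : ℝ, 0 < γ →
          (∫ θ in (0 : ℝ)..(2 * Real.pi),
              ((Psi u (vec2 (γ * Real.cos θ) (γ * Real.sin θ))) ^ 2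
                + γ ^ 2 * ‖gradPsi u (vec2 (γ * Real.cos θ) (γ * Real.sin θ))‖ ^ 2))
            ≤ Cα * γ ^ 2 * (1 + γ) ^ (-(2 * α))
                * (1 + if γ ≤ 1 then |Real.log γ| else 0)
                * ∫ y : E2, (u y) ^ 2 * (1 + ‖y‖) ^ (2 * α) := by
  obtain ⟨h0, h2⟩ := hα
  have hCQ := CQ_pos α h0 h2
  have hKK := KK_nonneg
  refine ⟨2 * CQ α * (KK + 1), by positivity, ?_⟩
  intro u hu hN hz γ hγ
  have hum := hu.measurable
  have hpi := Real.pi_pos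
  have hw : 0 < (1 + γ) ^ (-(2 * α)) := Real.rpow_pos_of_pos (by linarith) _
  have hL : 0 ≤ (if γ ≤ 1 then |Real.log γ| else 0) := by split_ifs <;> positivity
  set L := (if γ ≤ 1 then |Real.log γ| else 0)
  set X : ℝ → E2 := fun θ => vec2 (γ * Real.cos θ) (γ * Real.sin θ) with hX
  have hXn : ∀ θ, ‖X θ‖ = γ := fun θ => norm_polar γ θ hγ.le
  have hX0 : ∀ θ, X θ ≠ 0 := fun θ => by rw [← norm_pos_iff, hXn]; exact hγ
  have hXc : Measurable X := (cont_polar γ).measurable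
  set N := ∫ y : E2, (u y) ^ 2 * (1 + ‖y‖) ^ (2 * α) with hNdef
  have hN0 : 0 ≤ N := integral_nonneg fun y => by positivity
  have hNl : ENNReal.ofReal N = ∫⁻ y : E2, ENNReal.ofReal ((u y) ^ 2 * (1 + ‖y‖) ^ (2 * α)) :=
    ofReal_integral_eq_lintegral_ofReal hN (Filter.Eventually.of_forall fun y => by positivity)
  set Q : ℝ := CQ α * (γ ^ 2 * (1 + γ) ^ (-(2 * α)) * (1 + L)) with hQ
  have hQ0 : 0 ≤ Q := by positivity
  have hpt : ∀ θ, ‖(Psi u (X θ)) ^ 2 + γ ^ 2 * ‖gradPsi u (X θ)‖ ^ 2‖ₑ ≤ 2 * BB u (X θ) ^ 2 := by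
    intro θ
    have a1 := Psi_le u hu hz (X θ) (hX0 θ)
    have a2 := grad_le u hu hz (X θ) (hX0 θ)
    rw [hXn] at a2
    refine (enorm_add_le _ _).trans ?_
    rw [two_mul]
    refine add_le_add ?_ ?_
    · rw [enorm_pow]; exact pow_le_pow_left' a1 2
    · rw [← mul_pow, enorm_pow, enorm_mul, enorm_norm, Real.enorm_eq_ofReal hγ.le]
      exact pow_le_pow_left' a2 2
  have hD : ∫⁻ θ in Set.Ioc 0 (2 * Real.pi), ∫⁻ y : E2,
      ENNReal.ofReal ((u y) ^ 2 * (1 + ‖y‖) ^ (2 * α) * Real.sqrt (max γ ‖y‖ / ‖X θ - y‖))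
      ≤ ENNReal.ofReal N * ENNReal.ofReal KK := by
    rw [lintegral_lintegral_swap (by
      apply Measurable.aemeasurable
      unfold Function.uncurry
      fun_prop), hNl, ← lintegral_mul_const _ (by fun_prop)]
    refine lintegral_mono fun y => ?_
    have : ∀ θ, ENNReal.ofReal ((u y) ^ 2 * (1 + ‖y‖) ^ (2 * α) * Real.sqrt (max γ ‖y‖ / ‖X θ - y‖))
      = ENNReal.ofReal ((u y) ^ 2 * (1 + ‖y‖) ^ (2 * α)) * ENNReal.ofReal (Real.sqrt (max γ ‖y‖ / ‖X θ - y‖)) :=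
      fun θ => ENNReal.ofReal_mul (by positivity)
    simp only [this]
    rw [lintegral_const_mul' _ _ ENNReal.ofReal_ne_top]
    exact mul_le_mul_right (q_int γ hγ y) _
  have hmain : ‖∫ θ in (0 : ℝ)..(2 * Real.pi), ((Psi u (X θ)) ^ 2 + γ ^ 2 * ‖gradPsi u (X θ)‖ ^ 2)‖ₑ
      ≤ ENNReal.ofReal (2 * Q * (N * KK)) := by
    rw [intervalIntegral.integral_of_le (by linarith)]
    refine (enorm_integral_le_lintegral_enorm _).trans ?_
    calc _ ≤ ∫⁻ θ in Set.Ioc 0 (2 * Real.pi), 2 * ENNReal.ofReal Q * ∫⁻ y : E2,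
        ENNReal.ofReal ((u y) ^ 2 * (1 + ‖y‖) ^ (2 * α) * Real.sqrt (max γ ‖y‖ / ‖X θ - y‖)) := by
          refine lintegral_mono fun θ => (hpt θ).trans ?_
          rw [mul_assoc]
          refine mul_le_mul_right ?_ _
          refine (BB_sq α u hu (X θ) (hX0 θ)).trans ?_
          rw [hXn]
          exact mul_le_mul_left (pp_int α h0 h2 γ hγ (X θ) (hXn θ)) _
      _ = 2 * ENNReal.ofReal Q * ∫⁻ θ in Set.Ioc 0 (2 * Real.pi), ∫⁻ y : E2,
        ENNReal.ofReal ((u y) ^ 2 * (1 + ‖y‖) ^ (2 * α) * Real.sqrt (max γ ‖y‖ / ‖X θ - y‖)) := by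
          rw [lintegral_const_mul' _ _ (ENNReal.mul_ne_top (by norm_num) ENNReal.ofReal_ne_top)]
      _ ≤ 2 * ENNReal.ofReal Q * (ENNReal.ofReal N * ENNReal.ofReal KK) := mul_le_mul_right hD _
      _ = _ := by
          rw [ENNReal.ofReal_mul (p := 2 * Q) (by positivity), ENNReal.ofReal_mul (p := 2) (by positivity), ENNReal.ofReal_mul hN0]
          simp
  have hfin : (∫ θ in (0 : ℝ)..(2 * Real.pi), ((Psi u (X θ)) ^ 2 + γ ^ 2 * ‖gradPsi u (X θ)‖ ^ 2))
      ≤ 2 * Q * (N * KK) := by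
    rw [← ofReal_norm, ENNReal.ofReal_le_ofReal_iff (by positivity)] at hmain
    exact (Real.le_norm_self _).trans hmain
  refine hfin.trans ?_
  have : 0 ≤ 2 * Q * N := by positivity
  calc _ ≤ 2 * Q * (N * KK) + 2 * Q * N := by linarith
    _ = _ := by rw [hQ]; ring
end
end
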